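/- The emptiness problem for unary A1CAs is undecidable: there is no total computable function (with respect to a natural effective encoding of unary A1CAs, e.g., with state set Fin k) that, given a unary A1CA A, decides whether the language of A is empty. -/

import Mathlib

/-!
A realtime alternating one-counter automaton (A1CA) over the unary alphabet {1}.

* States are `Fin k`.
* Tape symbols are `Bool`: `true` is the end-marker ¢ and `false` is the input symbol 1.
* The counter status is a `Bool`: `true` means the counter is zero.
* Counter updates are encoded as `Fin 3`, with `d : Fin 3` denoting the integer `(d : ℤ) - 1`,
  i.e. one of −1, 0, +1.
* The automaton makes two transitions on each tape symbol of ¢ 1^m ¢; this is realized by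
  listing every tape symbol twice, one occurrence per transition.
-/
structure UnaryA1CA where
  /-- number of states -/
  k : ℕ
  /-- which states are universal (the rest are existential) -/
  isUniversal : Fin k → Bool
  /-- the initial state s₁ -/
  start : Fin k
  /-- the accepting state s_a -/
  accept : Fin k
  /-- transition function δ : S × {1,¢} × {zero, nonzero} → 𝒫(S × {−1,0,+1}) -/
  trans : Fin k → Bool → Bool → Finset (Fin k × Fin 3)

namespace UnaryA1CA

variable (A : UnaryA1CA)

/-- Successors of the configuration `(s, c)` on tape symbol `σ`. -/
def succs (s : Fin A.k) (c : ℤ) (σ : Bool) : Finset (Fin A.k × Fin 3) :=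
  A.trans s σ (decide (c = 0))

/-- AND–OR evaluation of the computation tree from configuration `cfg` on the remaining
list of tape symbols (each tape symbol occurs twice in the list, one per transition).
A leaf is true iff its state is the accepting state; an existential node is true iff some
successor is true; a universal node is true iff all successors are true. -/
def Acc : List Bool → Fin A.k × ℤ → Prop
  | [], cfg => cfg.1 = A.accept
  | σ :: rest, (s, c) =>
      if A.isUniversal s then
        ∀ t ∈ A.succs s c σ, Acc rest (t.1, c + (t.2 : ℤ) - 1)
      else
        ∃ t ∈ A.succs s c σ, Acc rest (t.1, c + (t.2 : ℤ) - 1)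

/-- The tape string ¢ w ¢ for an input `w ∈ {1}*`, with every tape symbol listed twice
(two transitions per tape symbol). -/
def tape (w : List Unit) : List Bool :=
  (true :: (w.map fun _ => false) ++ [true]).flatMap fun σ => [σ, σ]

/-- `A` accepts the unary input string `w`. -/
def Accepts (w : List Unit) : Prop :=
  A.Acc (tape w) (A.start, 0)

/-- The language of `A`, a set of unary strings. -/
def lang : Set (List Unit) := { w | A.Accepts w }

/-- A natural effective encoding of unary A1CAs as natural numbers, via the canonical
`Encodable` instance on the underlying data. -/
def encode (A : UnaryA1CA) : ℕ :=
  Encodable.encode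
    (⟨A.k, A.isUniversal, A.start, A.accept, A.trans⟩ :
      Σ k : ℕ, (Fin k → Bool) × Fin k × Fin k × (Fin k → Bool → Bool → Finset (Fin k × Fin 3)))

end UnaryA1CA

section TuringMachine

open Turing StateTransition

theorem trNat_two_pow (j : ℕ) :
    PartrecToTM2.trNat (2 ^ j) = List.replicate j PartrecToTM2.Γ'.bit0 ++ [PartrecToTM2.Γ'.bit1] := by
  have key : ∃ p : PosNum, ((2 ^ j : ℕ) : Num) = Num.pos p ∧
      PartrecToTM2.trPosNum p = List.replicate j PartrecToTM2.Γ'.bit0 ++ [PartrecToTM2.Γ'.bit1] := by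
    induction j with
    | zero => exact ⟨PosNum.one, by simp; rfl, rfl⟩
    | succ j ih =>
      obtain ⟨p, h1, h2⟩ := ih
      refine ⟨p.bit0, ?_, ?_⟩
      · rw [pow_succ, mul_two, Nat.cast_add, h1, Num.bit0_of_bit0]
        rfl
      · simp [PartrecToTM2.trPosNum, h2, List.replicate_succ]
  obtain ⟨p, h1, h2⟩ := key
  rw [PartrecToTM2.trNat, h1]
  exact h2

/-- Some partial recursive function has a non-computable set of exponents `n` for which it is
defined at `2 ^ (n + 1)`. -/
theorem exists_partrec_two_pow : ∃ g : ℕ →. ℕ, Partrec g ∧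
    ¬ ComputablePred fun n : ℕ => (g (2 ^ (n + 1))).Dom := by
  let r : ℕ →. ℕ := fun m => Nat.rfind fun k => Part.some (decide (2 ^ (k + 1) = m))
  have hr : Partrec r := by
    refine Partrec.rfind (p := fun (m k : ℕ) => Part.some (decide (2 ^ (k + 1) = m))) ?_
    refine Computable₂.partrec₂ (f := fun (m k : ℕ) => decide (2 ^ (k + 1) = m)) ?_
    have hp : Primrec fun q : ℕ × ℕ => 2 ^ (q.2 + 1) :=
      (Primrec₂.unpaired'.1 Nat.Primrec.pow).comp (Primrec.const 2)
        (Primrec.succ.comp Primrec.snd)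
    have := (PrimrecRel.comp Primrec.eq hp Primrec.fst).decide
    exact this.to_comp
  have hr' : ∀ n, r (2 ^ (n + 1)) = Part.some n := by
    intro n
    refine Part.eq_some_iff.2 (Nat.mem_rfind.2 ⟨by simp, ?_⟩)
    intro k hk
    simp only [Part.mem_some_iff]
    symm
    simp only [decide_eq_false_iff_not]
    intro h
    have := Nat.pow_right_injective le_rfl h
    omega
  refine ⟨fun m => (r m).bind fun n => (Denumerable.ofNat Nat.Partrec.Code n).eval 0, ?_, ?_⟩
  · refine hr.bind ?_
    refine (Nat.Partrec.Code.eval_part.comp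
      ((Computable.ofNat Nat.Partrec.Code).comp Computable.snd) (Computable.const 0))
  · intro h
    apply ComputablePred.halting_problem 0
    have h' : ComputablePred fun n : ℕ => ((Denumerable.ofNat Nat.Partrec.Code n).eval 0).Dom :=
      h.of_eq fun n => by simp [hr']
    obtain ⟨_, hc⟩ := h'
    refine ⟨fun _ => Classical.dec _, ?_⟩
    refine (hc.comp (Computable.encode (α := Nat.Partrec.Code))).of_eq fun c => ?_
    simp

/-- There is a one-tape machine, with finitely many symbols and labels, whose halting problem is
undecidable even for inputs of the form `z y x ⋯ x`. -/
theorem exists_undecidable_tm0 : ∃ (Γ Λ : Type) (_ : Inhabited Γ) (_ : Inhabited Λ) (_ : Finite Γ)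
    (_ : Finite Λ) (M : TM0.Machine Γ Λ) (x y z : Γ), ¬ ComputablePred fun n : ℕ =>
      (eval (TM0.step M) (TM0.init (z :: y :: List.replicate (n + 1) x))).Dom := by
  classical
  obtain ⟨g, hg, hundec⟩ := exists_partrec_two_pow
  obtain ⟨c, hc⟩ := ToPartrec.Code.exists_code (Nat.Partrec'.part_iff₁.2 hg)
  let iΛ : Inhabited PartrecToTM2.Λ' := ⟨PartrecToTM2.trNormal c PartrecToTM2.Cont'.halt⟩
  let : Fintype PartrecToTM2.K' :=
    ⟨{.main, .rev, .aux, .stack}, fun k => by cases k <;> simp⟩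
  have s2 := PartrecToTM2.tr_supports c PartrecToTM2.Cont'.halt
  have s1 := TM2to1.tr_supports _ s2
  have s0 := TM1to0.tr_supports _ s1
  set M₁ := TM2to1.tr PartrecToTM2.tr
  set M₀ := TM1to0.tr M₁
  set S := TM1to0.trStmts M₁ (TM2to1.trSupp PartrecToTM2.tr
    (PartrecToTM2.codeSupp c PartrecToTM2.Cont'.halt))
  let sym (b : Bool) (a : PartrecToTM2.Γ') :
      TM2to1.Γ' PartrecToTM2.K' fun _ => PartrecToTM2.Γ' :=
    (b, Function.update (fun _ => none) PartrecToTM2.K'.main (some a))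
  have hdom : ∀ n : ℕ, (eval (TM0.step M₀) (TM0.init (sym true .cons :: sym false .bit1 ::
      List.replicate (n + 1) (sym false .bit0)))).Dom ↔ (g (2 ^ (n + 1))).Dom := by
    intro n
    have e1 : ∀ l, (eval (TM0.step M₀) (TM0.init l)).Dom ↔ (TM1.eval M₁ l).Dom := by
      intro l
      rw [← TM1to0.tr_eval]
      rfl
    have e2 := TM2to1.tr_eval_dom PartrecToTM2.tr PartrecToTM2.K'.main
      (PartrecToTM2.trList [2 ^ (n + 1)])
    have e3 : TM2to1.trInit PartrecToTM2.K'.main (PartrecToTM2.trList [2 ^ (n + 1)]) =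
        sym true .cons :: sym false .bit1 ::
          List.replicate (n + 1) (sym false .bit0) := by
      have hrev : (PartrecToTM2.trList [2 ^ (n + 1)]).reverse =
          .cons :: .bit1 :: List.replicate (n + 1) .bit0 := by
        simp [PartrecToTM2.trList, trNat_two_pow]
      have hmap (j : ℕ) : List.map (sym false) (List.replicate j .bit0) =
          List.replicate j (sym false .bit0) := List.map_replicate
      rw [← hmap, TM2to1.trInit, hrev]
      rfl
    have e4 : (TM2.eval PartrecToTM2.tr PartrecToTM2.K'.main
        (PartrecToTM2.trList [2 ^ (n + 1)])).Dom ↔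
        (eval (TM2.step PartrecToTM2.tr) (PartrecToTM2.init c [2 ^ (n + 1)])).Dom := by
      have : TM2.init PartrecToTM2.K'.main (PartrecToTM2.trList [2 ^ (n + 1)]) =
          PartrecToTM2.init c [2 ^ (n + 1)] := by
        simp only [TM2.init, PartrecToTM2.init]
        congr 1
        funext k
        cases k <;> simp [PartrecToTM2.K'.elim, Function.update]
      rw [← this]
      rfl
    rw [e1, ← e3, e2, e4, PartrecToTM2.tr_eval]
    have := hc ⟨[2 ^ (n + 1)], rfl⟩
    simp only at this
    rw [this]
    rfl
  have hS : default ∈ (S : Set (TM1to0.Λ' M₁)) := s0.1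
  let iS : Inhabited S := ⟨⟨default, hS⟩⟩
  let g₁ : PointedMap (TM1to0.Λ' M₁) S :=
    ⟨fun q => if h : q ∈ S then ⟨q, h⟩ else default, by
      rw [dif_pos (show default ∈ S from hS)]; rfl⟩
  have hres := M₀.map_respects ⟨id, rfl⟩ ⟨id, rfl⟩ g₁ (fun q => q.1) s0 (fun _ => rfl)
    (fun q hq => by simp only [g₁]; rw [dif_pos (show q ∈ S from hq)])
  refine ⟨TM2to1.Γ' PartrecToTM2.K' fun _ => PartrecToTM2.Γ', S, inferInstance, iS,
    inferInstanceAs (Finite (Bool × (PartrecToTM2.K' → Option PartrecToTM2.Γ'))), inferInstance,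
    M₀.map ⟨id, rfl⟩ ⟨id, rfl⟩ g₁ (fun q => q.1),
    sym false .bit0, sym false .bit1, sym true .cons, ?_⟩
  intro h
  refine hundec (h.of_eq fun n => ?_)
  rw [← hdom n]
  refine tr_eval_dom hres ⟨hS, ?_⟩
  rw [TM0.map_init]
  simp

end TuringMachine

section CellularAutomaton

open Turing StateTransition

/-- The evolution of a one-dimensional cellular automaton, started from a configuration that is
blank except at the origin, applying the rule `δ true` at times `t < n` and `δ false` later. -/
def evolve {Q : Type*} (δ : Bool → Q → Q → Q → Q) (seed blank : Q) (n : ℕ) : ℕ → ℤ → Q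
  | 0, c => if c = 0 then seed else blank
  | t + 1, c => δ (decide (t < n)) (evolve δ seed blank n t (c - 1)) (evolve δ seed blank n t c)
      (evolve δ seed blank n t (c + 1))

variable {Γ Λ : Type*}

/-- The rule by which a head travels to the left, writing `y` and then a growing block of `x`. -/
def loadRule (x y : Γ) (l m r : Γ × Option Λ) : Γ × Option Λ :=
  if r.2.isSome then r
  else if m.2.isSome then (y, none)
  else if l.2.isSome then (x, none)
  else m

variable [Inhabited Γ] [Inhabited Λ]

/-- The new content of a cell after a step of the machine `M`. -/
def runSymbol (M : TM0.Machine Γ Λ) (m : Γ × Option Λ) : Γ :=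
  match m.2.bind fun q => M q m.1 with
  | some (_, .write a) => a
  | _ => m.1

/-- The head (if any) at a cell after a step of the machine `M`. -/
def runHead (M : TM0.Machine Γ Λ) (l m r : Γ × Option Λ) : Option Λ :=
  match m.2 with
  | some q =>
    match M q m.1 with
    | none => some q
    | some (q', .write _) => some q'
    | some (_, .move _) => none
  | none =>
    match l.2.bind fun q => M q l.1 with
    | some (q', .move .right) => some q'
    | _ =>
      match r.2.bind fun q => M q r.1 with
      | some (q', .move .left) => some q'
      | _ => none

/-- The cellular automaton which loads the input and then simulates the machine `M`. -/
def machineRule (M : TM0.Machine Γ Λ) (x y : Γ) :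
    Bool → Γ × Option Λ → Γ × Option Λ → Γ × Option Λ → Γ × Option Λ
  | true, l, m, r => loadRule x y l m r
  | false, l, m, r => (runSymbol M m, runHead M l m r)

/-- A cell at which the machine `M` has halted. -/
def IsHalted (M : TM0.Machine Γ Λ) (m : Γ × Option Λ) : Prop :=
  ∃ q, m.2 = some q ∧ M q m.1 = none

/-- The row of cells `f` shows the machine configuration `cfg` with its head at position `p`. -/
def Shows (cfg : TM0.Cfg Γ Λ) (p : ℤ) (f : ℤ → Γ × Option Λ) : Prop :=
  ∀ c, f c = (cfg.Tape.nth (c - p), if c = p then some cfg.q else none)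

variable {M : TM0.Machine Γ Λ} {x y z : Γ} {seed blank : Γ × Option Λ} {n t : ℕ}

theorem Shows.of_step_eq_none {cfg : TM0.Cfg Γ Λ} {p : ℤ} {f : ℤ → Γ × Option Λ}
    (h : Shows cfg p f) (hs : TM0.step M cfg = none) : IsHalted M (f p) := by
  refine ⟨cfg.q, by simp [h p], ?_⟩
  simpa [h p, TM0.step] using hs

theorem Shows.step_eq_none {cfg : TM0.Cfg Γ Λ} {p c : ℤ} {f : ℤ → Γ × Option Λ}
    (h : Shows cfg p f) (hc : IsHalted M (f c)) : TM0.step M cfg = none := by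
  obtain ⟨q, h1, h2⟩ := hc
  rw [h c] at h1 h2
  by_cases hcp : c = p
  · subst hcp
    simp only [if_true, Option.some.injEq, sub_self, Tape.nth_zero] at h1 h2
    subst h1
    simp [TM0.step, h2]
  · simp [hcp] at h1

theorem Shows.succ_of_none {cfg : TM0.Cfg Γ Λ} {p : ℤ} (hn : n ≤ t)
    (h : Shows cfg p (evolve (machineRule M x y) seed blank n t))
    (hs : TM0.step M cfg = none) :
    Shows cfg p (evolve (machineRule M x y) seed blank n (t + 1)) := by
  have hM : M cfg.q cfg.Tape.head = none := by simpa [TM0.step] using hs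
  intro c
  have hd : decide (t < n) = false := by simpa using hn
  rw [evolve, hd, h c, h (c - 1), h (c + 1)]
  by_cases h0 : c = p
  · subst h0
    simp [machineRule, runSymbol, runHead, hM]
  · by_cases h1 : c - 1 = p
    · subst h1
      have e1 : ¬ c + 1 = c - 1 := by omega
      simp [machineRule, runSymbol, runHead, hM, h0, e1]
    · by_cases h2 : c + 1 = p
      · subst h2
        simp [machineRule, runSymbol, runHead, hM, h0, h1]
      · simp [machineRule, runSymbol, runHead, h0, h1, h2]

theorem Shows.succ_of_some {cfg cfg' : TM0.Cfg Γ Λ} {p : ℤ} (hn : n ≤ t)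
    (h : Shows cfg p (evolve (machineRule M x y) seed blank n t))
    (hs : TM0.step M cfg = some cfg') :
    ∃ p', Shows cfg' p' (evolve (machineRule M x y) seed blank n (t + 1)) := by
  obtain ⟨q, T⟩ := cfg
  have hd : decide (t < n) = false := by simpa using hn
  simp only [TM0.step, Option.map_eq_some_iff] at hs
  obtain ⟨⟨q', s⟩, hM, rfl⟩ := hs
  have key : ∀ c, evolve (machineRule M x y) seed blank n (t + 1) c =
      machineRule M x y false (T.nth (c - 1 - p), if c - 1 = p then some q else none)
        (T.nth (c - p), if c = p then some q else none)
        (T.nth (c + 1 - p), if c + 1 = p then some q else none) := by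
    intro c
    rw [evolve, hd, h c, h (c - 1), h (c + 1)]
  rcases s with (_ | _) | a
  · refine ⟨p - 1, fun c => ?_⟩
    rw [key]
    simp only [Tape.move_left_nth]
    have e : c - (p - 1) - 1 = c - p := by ring
    rw [e]
    by_cases h0 : c = p
    · subst h0
      have e1 : ¬ c = c - 1 := by omega
      simp [machineRule, runSymbol, runHead, hM, e1]
    · by_cases h1 : c - 1 = p
      · subst h1
        have : ¬ c = c - 1 - 1 := by omega
        have e1 : ¬ c + 1 = c - 1 := by omega
        simp [machineRule, runSymbol, runHead, hM, this, h0, e1]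
      · by_cases h2 : c + 1 = p
        · subst h2
          simp [machineRule, runSymbol, runHead, hM, h0, h1]
        · have : ¬ c = p - 1 := by omega
          simp [machineRule, runSymbol, runHead, h0, h1, h2, this]
  · refine ⟨p + 1, fun c => ?_⟩
    rw [key]
    simp only [Tape.move_right_nth]
    have e : c - (p + 1) + 1 = c - p := by ring
    rw [e]
    by_cases h0 : c = p
    · subst h0
      have e2 : ¬ c = c + 1 := by omega
      simp [machineRule, runSymbol, runHead, hM, e2]
    · by_cases h1 : c - 1 = p
      · subst h1
        simp [machineRule, runSymbol, runHead, hM, h0]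
      · by_cases h2 : c + 1 = p
        · subst h2
          have : ¬ c = c + 1 + 1 := by omega
          simp [machineRule, runSymbol, runHead, hM, this, h0, h1]
        · have : ¬ c = p + 1 := by omega
          simp [machineRule, runSymbol, runHead, h0, h1, h2, this]
  · refine ⟨p, fun c => ?_⟩
    rw [key]
    simp only [Tape.write_nth]
    by_cases h0 : c = p
    · subst h0
      simp [machineRule, runSymbol, runHead, hM]
    · have h0' : ¬ c - p = 0 := by omega
      by_cases h1 : c - 1 = p
      · subst h1
        have e1 : ¬ c + 1 = c - 1 := by omega
        simp [machineRule, runSymbol, runHead, hM, h0, e1]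
      · by_cases h2 : c + 1 = p
        · subst h2
          simp [machineRule, runSymbol, runHead, hM, h0, h1]
        · simp [machineRule, runSymbol, runHead, h0, h0', h1, h2]

theorem evolve_loading (q : Λ) (t : ℕ) (ht : t + 1 ≤ n) (c : ℤ) :
    evolve (machineRule M x y) (z, some q) (default, none) n (t + 1) c =
      if c = -(t + 1) then (z, some q) else if c = -t then (y, none)
      else if -t < c ∧ c ≤ 1 then (x, none) else (default, none) := by
  induction t generalizing c with
  | zero =>
    have hd : decide (0 < n) = true := decide_eq_true (by omega)
    rw [evolve, hd]
    simp only [evolve, machineRule, loadRule]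
    split_ifs <;> first | rfl | omega | simp only [Option.isSome_some, Option.isSome_none,
      not_true_eq_false, Bool.false_eq_true] at *
  | succ t ih =>
    have hd : decide (t + 1 < n) = true := by simpa using ht
    rw [evolve, hd, ih (by omega), ih (by omega), ih (by omega)]
    simp only [machineRule, loadRule]
    push_cast
    by_cases h0 : c + 1 = -(t + 1)
    · simp [show c = -(t + 1 + 1) by omega]
    by_cases h1 : c = -(t + 1)
    · subst h1
      simp
    by_cases h2 : c - 1 = -(t + 1)
    · obtain rfl : c = -t := by omega
      rw [if_neg h0, if_neg h1, if_pos h2]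
      split_ifs <;> first | rfl | omega | simp_all
    · rw [if_neg h0, if_neg h1, if_neg h2]
      have h3 : ¬ c = -(t + 1 + 1) := by omega
      rw [if_neg h3, if_neg h1]
      split_ifs <;> first | rfl | omega | simp_all

theorem shows_loaded : Shows (TM0.init (z :: y :: List.replicate (n + 1) x)) (-(n + 1 : ℤ))
    (evolve (machineRule M x y) (z, some default) (default, none) (n + 1) (n + 1)) := by
  intro c
  rw [evolve_loading _ _ le_rfl]
  simp only [TM0.init]
  obtain ⟨i, rfl⟩ : ∃ i : ℤ, c = i - (n + 1) := ⟨c + (n + 1), by ring⟩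
  rw [show i - (n + 1) - -(n + 1 : ℤ) = i by ring]
  obtain k | k := i
  · have hk : (Tape.mk₁ (z :: y :: List.replicate (n + 1) x)).nth (Int.ofNat k) =
        (z :: y :: List.replicate (n + 1) x).getI k := by
      exact Tape.mk'_nth_nat _ _ _
    rw [hk]
    rcases k with _ | _ | k
    · simp [List.getI]
    · simp [List.getI]
    · by_cases hkn : k < n + 1
      · have : (z :: y :: List.replicate (n + 1) x).getI (k + 2) = x := by
          simp [List.getI, hkn]
        rw [this]
        simp only [Int.ofNat_eq_natCast]
        push_cast
        split_ifs <;> first | rfl | omega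
      · have : (z :: y :: List.replicate (n + 1) x).getI (k + 2) = default := by
          simp [List.getI, hkn]
        rw [this]
        simp only [Int.ofNat_eq_natCast]
        push_cast
        split_ifs <;> first | rfl | omega
  · have hk : (Tape.mk₁ (z :: y :: List.replicate (n + 1) x)).nth (Int.negSucc k) = default := rfl
    rw [hk]
    split_ifs <;> first | rfl | omega

theorem exists_isHalted_iff : (∃ t c, IsHalted M
      (evolve (machineRule M x y) (z, some default) (default, none) (n + 1) t c)) ↔
    (eval (TM0.step M) (TM0.init (z :: y :: List.replicate (n + 1) x))).Dom := by
  set init := TM0.init (Λ := Λ) (z :: y :: List.replicate (n + 1) x) with hinit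
  set f := evolve (machineRule M x y) (z, some default) (default, none) (n + 1) with hf
  constructor
  · rintro ⟨t, c, hh⟩
    have dom_of : ∀ {cfg}, Reaches (TM0.step M) init cfg → TM0.step M cfg = none →
        (eval (TM0.step M) init).Dom := fun h1 h2 =>
      Part.dom_iff_mem.2 ⟨_, mem_eval.2 ⟨h1, h2⟩⟩
    rcases lt_or_ge t (n + 1) with ht | ht
    · refine dom_of .refl ?_
      have hz : M default z = none := by
        obtain ⟨q, h1, h2⟩ := hh
        rcases t with _ | t
        · simp only [hf, evolve] at h1 h2
          split_ifs at h1 h2 with h0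
          simp_all
        · rw [hf, evolve_loading _ _ ht.le] at h1 h2
          split_ifs at h1 h2 with h0
          all_goals simp_all
      simp only [hinit, TM0.init, TM0.step]
      change Option.map _ (M default z) = none
      rw [hz]
      rfl
    · have inv : ∀ j, ∃ cfg p, Reaches (TM0.step M) init cfg ∧ Shows cfg p (f (n + 1 + j)) := by
        intro j
        induction j with
        | zero => exact ⟨_, _, .refl, shows_loaded⟩
        | succ j ih =>
          obtain ⟨cfg, p, h1, h2⟩ := ih
          rcases hs : TM0.step M cfg with _ | cfg'
          · exact ⟨cfg, p, h1, h2.succ_of_none (Nat.le_add_right _ _) hs⟩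
          · obtain ⟨p', h'⟩ := h2.succ_of_some (Nat.le_add_right _ _) hs
            exact ⟨cfg', p', h1.tail hs, h'⟩
      obtain ⟨j, rfl⟩ := Nat.exists_eq_add_of_le ht
      obtain ⟨cfg, p, h1, h2⟩ := inv j
      exact dom_of h1 (h2.step_eq_none hh)
  · intro hd
    obtain ⟨b, hb⟩ := Part.dom_iff_mem.1 hd
    obtain ⟨h1, h2⟩ := mem_eval.1 hb
    have inv : ∃ j p, Shows b p (f (n + 1 + j)) := by
      clear h2 hb hd
      induction h1 with
      | refl => exact ⟨0, _, shows_loaded⟩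
      | tail _ hs ih =>
        obtain ⟨j, p, h⟩ := ih
        obtain ⟨p', h'⟩ := h.succ_of_some (Nat.le_add_right _ _) hs
        exact ⟨j + 1, p', h'⟩
    obtain ⟨j, p, h⟩ := inv
    exact ⟨_, _, h.of_step_eq_none h2⟩

end CellularAutomaton

section AlternatingEvaluation

/-- AND–OR evaluation of the computation tree of a possibly infinite alternating one-counter
machine given by its transition relation `R`. -/
def TreeAcc {X : Type*} (R : X → Bool → Bool → X → Fin 3 → Prop) (U : X → Prop) (a : X) :
    List Bool → X → ℤ → Prop
  | [], s, _ => s = a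
  | σ :: l, s, c =>
    (U s ∧ ∀ s' d, R s σ (decide (c = 0)) s' d → TreeAcc R U a l s' (c + (d : ℕ) - 1)) ∨
    (¬ U s ∧ ∃ s' d, R s σ (decide (c = 0)) s' d ∧ TreeAcc R U a l s' (c + (d : ℕ) - 1))

/-- The control states of the automaton which guesses the history of a cellular automaton. -/
inductive Control (Q : Type) : Type
  | letter (q : Q)
  | clause (b : Bool) (l m r : Q)
  | accept
  | start
  | started
  | search
  | searching

instance {Q : Type} [Finite Q] : Finite (Control Q) := by
  let f : Control Q → Q ⊕ (Bool × Q × Q × Q) ⊕ Fin 5 := fun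
    | .letter q => .inl q
    | .clause b l m r => .inr (.inl (b, l, m, r))
    | .accept => .inr (.inr 0)
    | .start => .inr (.inr 1)
    | .started => .inr (.inr 2)
    | .search => .inr (.inr 3)
    | .searching => .inr (.inr 4)
  refine Finite.of_injective f fun a b h => ?_
  cases a <;> cases b <;> simp_all [f]

variable {Q : Type}

/-- The transition relation of the automaton which guesses the history of a cellular automaton.
The states `Sum.inr j` form two clocks (for `j` even and odd) measuring the remaining input. -/
inductive Guess (δ : Bool → Q → Q → Q → Q) (seed blank : Q) (H : Q → Prop) (n : ℕ) :
    Control Q ⊕ ℕ → Bool → Bool → Control Q ⊕ ℕ → Fin 3 → Prop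
  | seed : Guess δ seed blank H n (.inl (.letter seed)) true true (.inl .accept) 1
  | blank : Guess δ seed blank H n (.inl (.letter blank)) true false (.inl .accept) 1
  | rule (b : Bool) (l m r q : Q) (h : δ b l m r = q) (z : Bool) :
      Guess δ seed blank H n (.inl (.letter q)) false z (.inl (.clause b l m r)) 1
  | left (b : Bool) (l m r : Q) (z : Bool) :
      Guess δ seed blank H n (.inl (.clause b l m r)) false z (.inl (.letter l)) 0
  | middle (b : Bool) (l m r : Q) (z : Bool) :
      Guess δ seed blank H n (.inl (.clause b l m r)) false z (.inl (.letter m)) 1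
  | right (b : Bool) (l m r : Q) (z : Bool) :
      Guess δ seed blank H n (.inl (.clause b l m r)) false z (.inl (.letter r)) 2
  | clock (b : Bool) (l m r : Q) (z : Bool) :
      Guess δ seed blank H n (.inl (.clause b l m r)) false z (.inr (if b then 0 else 1)) 1
  | start (z : Bool) : Guess δ seed blank H n (.inl .start) true z (.inl .started) 1
  | started (z : Bool) : Guess δ seed blank H n (.inl .started) true z (.inl .search) 1
  | move (z : Bool) (d : Fin 3) :
      Guess δ seed blank H n (.inl .search) false z (.inl .searching) d
  | resume (z : Bool) : Guess δ seed blank H n (.inl .searching) false z (.inl .search) 1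
  | found (z : Bool) (q : Q) (h : H q) :
      Guess δ seed blank H n (.inl .searching) false z (.inl (.letter q)) 1
  | tick (j : ℕ) (h : j < 4 * n) (z : Bool) :
      Guess δ seed blank H n (.inr j) false z (.inr (j + 2)) 1
  | early (j : ℕ) (h : j % 2 = 0) (z : Bool) :
      Guess δ seed blank H n (.inr j) true z (.inl .accept) 1
  | late (j : ℕ) (h : j = 4 * n + 1) (z : Bool) :
      Guess δ seed blank H n (.inr j) false z (.inl .accept) 1

/-- The universal states among the states of `Guess`. -/
inductive Branching : Control Q ⊕ ℕ → Prop
  | clause (b : Bool) (l m r : Q) : Branching (.inl (.clause b l m r))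
  | accept : Branching (.inl .accept)

theorem Branching.not_clock (j : ℕ) : ¬ Branching (.inr j : Control Q ⊕ ℕ) := nofun

theorem Branching.not_letter (q : Q) : ¬ Branching (.inl (.letter q)) := nofun

theorem Branching.not_start : ¬ Branching (.inl .start : Control Q ⊕ ℕ) := nofun

theorem Branching.not_started : ¬ Branching (.inl .started : Control Q ⊕ ℕ) := nofun

theorem Branching.not_search : ¬ Branching (.inl .search : Control Q ⊕ ℕ) := nofun

theorem Branching.not_searching : ¬ Branching (.inl .searching : Control Q ⊕ ℕ) := nofun

/-- The part of the tape which remains after reading the left end-marker, and which contains `r`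
copies of the input symbol. -/
def remaining (r : ℕ) : List Bool := List.replicate r false ++ [true, true]

theorem remaining_zero : remaining 0 = [true, true] := rfl

theorem remaining_succ (r : ℕ) : remaining (r + 1) = false :: remaining r := rfl

variable {δ : Bool → Q → Q → Q → Q} {seed blank : Q} {H : Q → Prop} {n : ℕ}

variable (δ seed blank H n) in
/-- The evaluation of the computation tree of `Guess`. -/
abbrev GuessAcc (l : List Bool) (s : Control Q ⊕ ℕ) (c : ℤ) : Prop :=
  TreeAcc (Guess δ seed blank H n) Branching (.inl .accept) l s c

theorem guessAcc_accept (l : List Bool) (c : ℤ) :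
    GuessAcc δ seed blank H n l (.inl .accept) c := by
  cases l with
  | nil => rfl
  | cons σ l => exact Or.inl ⟨.accept, fun s' d h => nomatch h⟩

theorem guessAcc_cons_of_not_branching {σ : Bool} {l : List Bool} {s : Control Q ⊕ ℕ} {c : ℤ}
    (hs : ¬ Branching s) : GuessAcc δ seed blank H n (σ :: l) s c ↔
      ∃ s' d, Guess δ seed blank H n s σ (decide (c = 0)) s' d ∧
        GuessAcc δ seed blank H n l s' (c + (d : ℕ) - 1) := by
  simp [GuessAcc, TreeAcc, hs]

theorem guessAcc_clock_aux (r i : ℕ) (hi : i ≤ 2 * n) (c : ℤ) :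
    (GuessAcc δ seed blank H n (remaining r) (.inr (2 * (2 * n - i))) c ↔ r ≤ i) ∧
    (GuessAcc δ seed blank H n (remaining r) (.inr (2 * (2 * n - i) + 1)) c ↔ i < r) := by
  induction r generalizing i c with
  | zero =>
    rw [remaining_zero, guessAcc_cons_of_not_branching (Branching.not_clock _),
      guessAcc_cons_of_not_branching (Branching.not_clock _)]
    constructor
    · simp only [Nat.zero_le, iff_true]
      exact ⟨_, _, .early _ (by omega) _, guessAcc_accept _ _⟩
    · simp only [Nat.not_lt_zero, iff_false]
      rintro ⟨s, d, h, -⟩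
      cases h with
      | early j h => omega
  | succ r ih =>
    rw [remaining_succ, guessAcc_cons_of_not_branching (Branching.not_clock _),
      guessAcc_cons_of_not_branching (Branching.not_clock _)]
    rcases i with _ | i
    · constructor
      · simp only [Nat.le_zero, Nat.add_one_ne_zero, iff_false]
        rintro ⟨s, d, h, -⟩
        cases h with
        | tick j h => omega
        | late j h => omega
      · simp only [Nat.succ_pos, iff_true]
        exact ⟨_, _, .late _ (by omega) _, guessAcc_accept _ _⟩
    · have e : 2 * (2 * n - (i + 1)) + 2 = 2 * (2 * n - i) := by omega
      constructor
      · rw [Nat.add_le_add_iff_right, ← (ih i (by omega) (c + ((1 : Fin 3) : ℕ) - 1)).1]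
        constructor
        · rintro ⟨s, d, h, h'⟩
          cases h with
          | tick j h => rwa [e] at h'
          | late j h => omega
        · intro h
          exact ⟨_, _, .tick _ (by omega) _, by rwa [e]⟩
      · have e' : 2 * (2 * n - (i + 1)) + 1 + 2 = 2 * (2 * n - i) + 1 := by omega
        rw [Nat.add_lt_add_iff_right, ← (ih i (by omega) (c + ((1 : Fin 3) : ℕ) - 1)).2]
        constructor
        · rintro ⟨s, d, h, h'⟩
          cases h with
          | tick j h => rwa [e'] at h'
          | late j h => omega
        · intro h
          exact ⟨_, _, .tick _ (by omega) _, by rwa [e']⟩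

theorem guessAcc_clock (t : ℕ) (b : Bool) (c : ℤ) :
    GuessAcc δ seed blank H n (remaining (2 * t)) (.inr (if b then 0 else 1)) c ↔
      decide (t < n + 1) = b := by
  have h := guessAcc_clock_aux (δ := δ) (seed := seed) (blank := blank) (H := H) (2 * t) (2 * n)
    le_rfl c
  simp only [Nat.sub_self, Nat.mul_zero, Nat.zero_add] at h
  cases b
  · simp only [Bool.false_eq_true, if_false, h.2, decide_eq_false_iff_not]
    omega
  · simp only [if_true, h.1, decide_eq_true_eq]
    omega

theorem guessAcc_letter (t : ℕ) (q : Q) (c : ℤ) :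
    GuessAcc δ seed blank H n (remaining (2 * t)) (.inl (.letter q)) c ↔
      evolve δ seed blank (n + 1) t c = q := by
  induction t generalizing q c with
  | zero =>
    rw [Nat.mul_zero, remaining_zero, guessAcc_cons_of_not_branching (Branching.not_letter _), evolve]
    by_cases hc : c = 0
    · simp only [hc, if_true, decide_true]
      constructor
      · rintro ⟨s, d, h, -⟩
        cases h
        rfl
      · rintro rfl
        exact ⟨_, _, .seed, guessAcc_accept _ _⟩
    · simp only [hc, if_false, decide_false]
      constructor
      · rintro ⟨s, d, h, -⟩
        cases h
        rfl
      · rintro rfl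
        exact ⟨_, _, .blank, guessAcc_accept _ _⟩
  | succ t ih =>
    have hclause : ∀ b l m r (c : ℤ),
        GuessAcc δ seed blank H n (remaining (2 * t + 1)) (.inl (.clause b l m r)) c ↔
        decide (t < n + 1) = b ∧ evolve δ seed blank (n + 1) t (c - 1) = l ∧
          evolve δ seed blank (n + 1) t c = m ∧ evolve δ seed blank (n + 1) t (c + 1) = r := by
      intro b l m r c
      rw [remaining_succ, ← guessAcc_clock (δ := δ) (seed := seed) (blank := blank) (H := H) t b c,
        ← ih, ← ih, ← ih]
      constructor
      · rintro (⟨-, h⟩ | ⟨h, -⟩)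
        · refine ⟨?_, ?_, ?_, ?_⟩
          · simpa using h _ _ (.clock b l m r _)
          · simpa using h _ _ (.left b l m r _)
          · simpa using h _ _ (.middle b l m r _)
          · have := h _ _ (.right b l m r _)
            convert this using 1
            simp
            ring
        · exact absurd (.clause b l m r) h
      · rintro ⟨h1, h2, h3, h4⟩
        refine Or.inl ⟨.clause b l m r, fun s d h => ?_⟩
        cases h with
        | clock => simpa using h1
        | left => simpa using h2
        | middle => simpa using h3
        | right =>
          convert h4 using 1
          simp
          ring
    rw [show 2 * (t + 1) = 2 * t + 1 + 1 by ring, remaining_succ,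
      guessAcc_cons_of_not_branching (Branching.not_letter _), evolve]
    constructor
    · rintro ⟨s, d, h, h'⟩
      cases h with
      | rule b l m r q h =>
        obtain ⟨rfl, rfl, rfl, rfl⟩ := (hclause _ _ _ _ _).1 h'
        simpa using h
    · intro h
      refine ⟨_, _, .rule _ _ _ _ _ h _, (hclause _ _ _ _ _).2 ?_⟩
      simp

theorem guessAcc_search_succ (t : ℕ) (c : ℤ) :
    GuessAcc δ seed blank H n (remaining (2 * (t + 1))) (.inl .search) c ↔
      ∃ d : Fin 3, GuessAcc δ seed blank H n (remaining (2 * t)) (.inl .search) (c + (d : ℕ) - 1) ∨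
        H (evolve δ seed blank (n + 1) t (c + (d : ℕ) - 1)) := by
  rw [show 2 * (t + 1) = 2 * t + 1 + 1 by ring, remaining_succ, remaining_succ,
    guessAcc_cons_of_not_branching Branching.not_search]
  constructor
  · rintro ⟨s, d, h, h'⟩
    refine ⟨d, ?_⟩
    cases h with
    | move =>
      rw [guessAcc_cons_of_not_branching Branching.not_searching] at h'
      obtain ⟨s, d', h, h'⟩ := h'
      cases h with
      | resume => exact Or.inl (by simpa using h')
      | found _ q hq =>
        rw [guessAcc_letter] at h'
        refine Or.inr ?_
        rw [← h'] at hq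
        simpa using hq
  · rintro ⟨d, h⟩
    refine ⟨_, d, .move _ d, (guessAcc_cons_of_not_branching Branching.not_searching).2 ?_⟩
    rcases h with h | h
    · exact ⟨_, _, .resume _, by simpa using h⟩
    · exact ⟨_, _, .found _ _ h, (guessAcc_letter _ _ _).2 (by simp)⟩

theorem exists_of_guessAcc_search {t : ℕ} {c : ℤ}
    (h : GuessAcc δ seed blank H n (remaining (2 * t)) (.inl .search) c) :
    ∃ t c, H (evolve δ seed blank (n + 1) t c) := by
  induction t generalizing c with
  | zero =>
    rw [Nat.mul_zero, remaining_zero, guessAcc_cons_of_not_branching Branching.not_search] at h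
    obtain ⟨s, d, h, -⟩ := h
    nomatch h
  | succ t ih =>
    obtain ⟨d, h | h⟩ := (guessAcc_search_succ _ _).1 h
    · exact ih h
    · exact ⟨_, _, h⟩

theorem guessAcc_search_add {t : ℕ} {c : ℤ} (h : H (evolve δ seed blank (n + 1) t c)) (j : ℕ)
    (e : ℤ) (he : |e| ≤ j + 1) :
    GuessAcc δ seed blank H n (remaining (2 * (t + j + 1))) (.inl .search) (c + e) := by
  have hd : ∀ e : ℤ, |e| ≤ 1 → ∃ d : Fin 3, e = 1 - (d : ℕ) := by
    intro e he
    rw [abs_le] at he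
    rcases (by omega : e = -1 ∨ e = 0 ∨ e = 1) with rfl | rfl | rfl
    · exact ⟨2, rfl⟩
    · exact ⟨1, rfl⟩
    · exact ⟨0, rfl⟩
  rw [guessAcc_search_succ]
  induction j generalizing e with
  | zero =>
    obtain ⟨d, rfl⟩ := hd e (by simpa using he)
    refine ⟨d, Or.inr ?_⟩
    rwa [show c + (1 - (d : ℕ)) + (d : ℕ) - 1 = c by ring]
  | succ j ih =>
    have : ∃ e' : ℤ, |e'| ≤ 1 ∧ |e - e'| ≤ j + 1 := by
      push_cast at he
      rw [abs_le] at he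
      rcases lt_trichotomy e 0 with h0 | h0 | h0
      · exact ⟨-1, by simp, abs_le.2 (by omega)⟩
      · exact ⟨0, by simp, abs_le.2 (by omega)⟩
      · exact ⟨1, by simp, abs_le.2 (by omega)⟩
    obtain ⟨e', h1, h2⟩ := this
    obtain ⟨d, rfl⟩ := hd e' h1
    refine ⟨d, Or.inl ?_⟩
    have := (guessAcc_search_succ _ _).2 (ih _ h2)
    rw [show c + e + (d : ℕ) - 1 = c + (e - (1 - (d : ℕ))) by ring]
    exact this

theorem exists_guessAcc_iff :
    (∃ t, GuessAcc δ seed blank H n (true :: true :: remaining (2 * t)) (.inl .start) 0) ↔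
      ∃ t c, H (evolve δ seed blank (n + 1) t c) := by
  constructor
  · rintro ⟨t, h⟩
    rw [guessAcc_cons_of_not_branching Branching.not_start] at h
    obtain ⟨s, d, h, h'⟩ := h
    cases h
    rw [guessAcc_cons_of_not_branching Branching.not_started] at h'
    obtain ⟨s, d, h, h'⟩ := h'
    cases h
    exact exists_of_guessAcc_search h'
  · rintro ⟨t, c, h⟩
    refine ⟨t + c.natAbs + 1, ?_⟩
    refine (guessAcc_cons_of_not_branching Branching.not_start).2 ⟨_, _, .start _, ?_⟩
    refine (guessAcc_cons_of_not_branching Branching.not_started).2 ⟨_, _, .started _, ?_⟩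
    have := guessAcc_search_add h c.natAbs (-c) (by simp)
    simpa using this

end AlternatingEvaluation

section Encoding

open Encodable

/-- The code of a function from `Bool` in terms of the codes of its values. -/
def boolFunctionCode (a b : ℕ) : ℕ :=
  encode (List.ofFn fun i : Fin (Fintype.card Bool) =>
    Nat.pair i (cond ((fintypeEquivFin (α := Bool)).symm i) b a))

theorem primrec_boolFunctionCode : Primrec₂ boolFunctionCode := by
  refine Primrec.encode.comp (Primrec.list_ofFn fun i => ?_)
  refine Primrec₂.natPair.comp (.const _) ?_
  cases (fintypeEquivFin (α := Bool)).symm i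
  · exact Primrec.fst
  · exact Primrec.snd

theorem encode_list_map {α : Type*} [Encodable α] (l : List α) :
    encode (l.map encode) = encode l := by
  induction l with
  | nil => rfl
  | cons a l ih => simp [encode_list_cons, ih]

theorem encode_fin_function {α : Type*} [Encodable α] {k : ℕ} (h : Fin k → α) :
    encode h = encode (List.ofFn fun i => Nat.pair i (encode (h i))) := by
  let e := Equiv.piEquivSubtypeSigma (Fin k) fun _ => α
  have h1 : encode h = @encode _ (@Subtype.encodable _ _ finArrow _) (e h) :=
    @encode_ofEquiv _ _ (@Subtype.encodable _ _ finArrow _) e h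
  have h2 : @encode _ (@Subtype.encodable _ _ finArrow _) (e h) =
      encode (List.ofFn fun i : Fin k => (⟨i, h i⟩ : Σ _ : Fin k, α)) := by
    rw [← List.Vector.toList_ofFn]
    exact @encode_ofEquiv (List.Vector (Σ _ : Fin k, α) k) _ _ (Equiv.vectorEquivFin _ _).symm _
  rw [h1, h2, ← encode_list_map, List.map_ofFn]
  rfl

theorem encode_bool_function {α : Type*} [Encodable α] (h : Bool → α) :
    encode h = boolFunctionCode (encode (h false)) (encode (h true)) := by
  refine (encode_ofEquiv (Equiv.arrowCongr fintypeEquivFin (Equiv.refl _)) h).trans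
    ((encode_fin_function _).trans ?_)
  refine congrArg encode (congrArg List.ofFn (funext fun i => ?_))
  simp only [Equiv.arrowCongr_apply, Function.comp_apply, Equiv.refl_apply]
  cases (fintypeEquivFin (α := Bool)).symm i <;> rfl

theorem encode_fin_function_eq_range {α : Type*} [Encodable α] {k : ℕ} (h : Fin k → α)
    (g : ℕ → ℕ) (hg : ∀ i : Fin k, encode (h i) = g i) :
    encode h = encode ((List.range k).map fun i => Nat.pair i (g i)) := by
  rw [encode_fin_function, ← List.map_coe_finRange_eq_range, List.map_map, List.ofFn_eq_map]
  refine congrArg encode (List.map_congr_left fun i _ => ?_)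
  simp [hg]

theorem encode_finset {α : Type*} [Encodable α] (s : Finset α) :
    encode s = encode (s.sort (encode' α ⁻¹'o (· ≤ ·))) := rfl

theorem encode_finset_map {α β : Type*} [Encodable α] [Encodable β] (f : α ↪ β)
    (hf : ∀ a, encode (f a) = encode a) (s : Finset α) : encode (s.map f) = encode s := by
  rw [encode_finset, encode_finset, ← encode_list_map (s.sort _),
    ← Finset.map_sort f s (encode' α ⁻¹'o (· ≤ ·)), ← encode_list_map, List.map_map]
  · simp [Function.comp_def, hf]
  · intro a _ b _
    simp [Order.Preimage, encode', hf]

theorem encode_finset_singleton {α : Type*} [Encodable α] (a : α) :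
    encode ({a} : Finset α) = Nat.succ (Nat.pair (encode a) 0) := by
  rw [encode_finset, Finset.sort_singleton]
  rfl

theorem primrec_ite_lt {g : ℕ → ℕ → ℕ} (hg : Primrec₂ g) (f : ℕ → ℕ) (k : ℕ) :
    Primrec₂ fun n i => if i < k then f i else g n i := by
  induction k with
  | zero => simpa using hg
  | succ k ih =>
    have h : Primrec₂ fun n i => if i = k then f k else if i < k then f i else g n i :=
      Primrec.ite (Primrec.eq.comp .snd (.const k)) (.const _) ih
    refine h.of_eq fun n i => ?_
    split_ifs <;> first | rfl | omega | simp_all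

end Encoding

section HistoryAutomaton

variable {Q : Type} [Finite Q]

/-- The numbering of the states of `Guess`. -/
noncomputable def stateNumber (Q : Type) [Finite Q] : Control Q ⊕ ℕ ≃ ℕ :=
  ((Finite.equivFin (Control Q)).sumCongr (Equiv.refl ℕ)).trans
    (finSumNatEquiv (Nat.card (Control Q)))

theorem stateNumber_inl_lt (s : Control Q) : stateNumber Q (.inl s) < Nat.card (Control Q) := by
  simp [stateNumber]

theorem stateNumber_inr (j : ℕ) : stateNumber Q (.inr j) = Nat.card (Control Q) + j := by
  simp [stateNumber]

theorem exists_stateNumber_symm_of_lt {i : ℕ} (hi : i < Nat.card (Control Q)) :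
    ∃ s, (stateNumber Q).symm i = .inl s := by
  refine ⟨(Finite.equivFin (Control Q)).symm ⟨i, hi⟩, ?_⟩
  simp [stateNumber, hi]

theorem stateNumber_symm_of_le {i : ℕ} (hi : Nat.card (Control Q) ≤ i) :
    (stateNumber Q).symm i = .inr (i - Nat.card (Control Q)) := by
  simp [stateNumber, hi]

variable (δ : Bool → Q → Q → Q → Q) (seed blank : Q) (H : Q → Prop) (n : ℕ)

open Classical in
/-- The automaton which guesses the history of a cellular automaton. -/
noncomputable def historyAutomaton : UnaryA1CA where
  k := Nat.card (Control Q) + (4 * n + 2)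
  isUniversal i := decide (Branching ((stateNumber Q).symm i))
  start := ⟨stateNumber Q (.inl .start), (stateNumber_inl_lt _).trans_le (Nat.le_add_right _ _)⟩
  accept := ⟨stateNumber Q (.inl .accept), (stateNumber_inl_lt _).trans_le (Nat.le_add_right _ _)⟩
  trans i σ z := Finset.univ.filter fun p =>
    Guess δ seed blank H n ((stateNumber Q).symm i) σ z ((stateNumber Q).symm p.1) p.2

variable {δ seed blank H n}

theorem mem_historyAutomaton_trans {i : Fin (historyAutomaton δ seed blank H n).k} {σ z : Bool}
    {p : Fin (historyAutomaton δ seed blank H n).k × Fin 3} :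
    p ∈ (historyAutomaton δ seed blank H n).trans i σ z ↔
      Guess δ seed blank H n ((stateNumber Q).symm i) σ z ((stateNumber Q).symm p.1) p.2 := by
  classical exact Finset.mem_filter.trans (and_iff_right (Finset.mem_univ _))

theorem Guess.stateNumber_lt {s s' : Control Q ⊕ ℕ} {σ z : Bool} {d : Fin 3}
    (h : Guess δ seed blank H n s σ z s' d) :
    stateNumber Q s' < (historyAutomaton δ seed blank H n).k := by
  rcases s' with s' | j
  · exact (stateNumber_inl_lt _).trans_le (Nat.le_add_right _ _)
  · rw [stateNumber_inr]
    change _ < Nat.card (Control Q) + (4 * n + 2)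
    generalize hj : (Sum.inr j : Control Q ⊕ ℕ) = s' at h
    cases h with
    | clock b => cases b <;> cases hj <;> simp
    | tick j => cases hj; omega
    | _ => cases hj

theorem historyAutomaton_acc_iff (l : List Bool) (i : Fin (historyAutomaton δ seed blank H n).k)
    (c : ℤ) : (historyAutomaton δ seed blank H n).Acc l (i, c) ↔
      GuessAcc δ seed blank H n l ((stateNumber Q).symm i) c := by
  induction l generalizing i c with
  | nil =>
    rw [UnaryA1CA.Acc, GuessAcc, TreeAcc, Equiv.symm_apply_eq, Fin.ext_iff]
    rfl
  | cons σ l ih =>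
    have hk : ∀ {s' d}, Guess δ seed blank H n ((stateNumber Q).symm i) σ (decide (c = 0)) s' d →
        ∃ j : Fin (historyAutomaton δ seed blank H n).k, (stateNumber Q).symm j = s' :=
      fun h => ⟨⟨_, h.stateNumber_lt⟩, Equiv.symm_apply_apply _ _⟩
    have hm : ∀ p, p ∈ (historyAutomaton δ seed blank H n).succs i c σ ↔
        Guess δ seed blank H n ((stateNumber Q).symm i) σ (decide (c = 0))
          ((stateNumber Q).symm p.1) p.2 :=
      fun p => mem_historyAutomaton_trans
    have hu : (historyAutomaton δ seed blank H n).isUniversal i = true ↔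
        Branching ((stateNumber Q).symm i) := by
      simp [historyAutomaton]
    rw [UnaryA1CA.Acc, GuessAcc, TreeAcc]
    simp only [ih, hm, Prod.forall, Prod.exists]
    by_cases hb : Branching ((stateNumber Q).symm i)
    · rw [if_pos (hu.2 hb)]
      simp only [hb, true_and, not_true_eq_false, false_and, or_false]
      constructor
      · intro h s' d hs
        obtain ⟨j, rfl⟩ := hk hs
        exact h j d hs
      · intro h j d hs
        exact h _ d hs
    · rw [if_neg (hu.not.2 hb)]
      simp only [hb, not_false_eq_true, true_and, false_and, false_or]
      constructor
      · rintro ⟨j, d, hs, h⟩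
        exact ⟨_, d, hs, h⟩
      · rintro ⟨s', d, hs, h⟩
        obtain ⟨j, rfl⟩ := hk hs
        exact ⟨j, d, hs, h⟩

theorem tape_eq (w : List Unit) :
    UnaryA1CA.tape w = true :: true :: remaining (2 * w.length) := by
  have h : ((w.map fun _ => false) ++ [true]).flatMap (fun σ => [σ, σ]) =
      remaining (2 * w.length) := by
    induction w with
    | nil => rfl
    | cons u w ih =>
      rw [List.map_cons, List.cons_append, List.flatMap_cons, ih, List.length_cons,
        show 2 * (w.length + 1) = 2 * w.length + 1 + 1 by ring, remaining_succ, remaining_succ]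
      rfl
  rw [UnaryA1CA.tape, List.cons_append, List.flatMap_cons, h]
  rfl

theorem historyAutomaton_lang_ne_empty_iff :
    (historyAutomaton δ seed blank H n).lang ≠ ∅ ↔ ∃ t c, H (evolve δ seed blank (n + 1) t c) := by
  rw [← exists_guessAcc_iff, ← Set.nonempty_iff_ne_empty]
  have h : ∀ w, w ∈ (historyAutomaton δ seed blank H n).lang ↔
      GuessAcc δ seed blank H n (true :: true :: remaining (2 * w.length)) (.inl .start) 0 := by
    intro w
    rw [UnaryA1CA.lang, Set.mem_ofPred_eq, UnaryA1CA.Accepts, historyAutomaton_acc_iff, tape_eq]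
    simp [historyAutomaton]
  constructor
  · rintro ⟨w, hw⟩
    exact ⟨_, (h w).1 hw⟩
  · rintro ⟨t, ht⟩
    exact ⟨List.replicate t (), (h _).2 (by simpa using ht)⟩

open Encodable

/-- The moves of the clock state `j`, when there are `k` control states and the accepting state is
`a`. -/
def clockMoves (k a n j : ℕ) (σ : Bool) : Finset (ℕ × Fin 3) :=
  if σ then if j % 2 = 0 then {(a, 1)} else ∅
  else if j < 4 * n then {(k + j + 2, 1)} else if j = 4 * n + 1 then {(a, 1)} else ∅

/-- The code of the transitions from a clock state. -/
def clockCode (k a n j : ℕ) : ℕ :=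
  boolFunctionCode
    (boolFunctionCode (encode (clockMoves k a n j false)) (encode (clockMoves k a n j false)))
    (boolFunctionCode (encode (clockMoves k a n j true)) (encode (clockMoves k a n j true)))

theorem primrec_clockCode (k a : ℕ) : Primrec₂ (clockCode k a) := by
  have hs : ∀ {f : ℕ × ℕ → ℕ}, Primrec f →
      Primrec fun p => encode ({(f p, 1)} : Finset (ℕ × Fin 3)) := by
    intro f hf
    simp only [encode_finset_singleton]
    exact Primrec.succ.comp (Primrec₂.natPair.comp
      (Primrec.encode.comp (Primrec.pair hf (.const 1))) (.const 0))
  have hn : Primrec fun p : ℕ × ℕ => 4 * p.1 := Primrec.nat_mul.comp (.const 4) .fst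
  have hf : Primrec fun p : ℕ × ℕ => encode (clockMoves k a p.1 p.2 false) := by
    have := Primrec.ite (Primrec.nat_lt.comp Primrec.snd hn)
      (hs (f := fun p => k + p.2 + 2) (Primrec.nat_add.comp
        (Primrec.nat_add.comp (.const k) .snd) (.const 2)))
      (Primrec.ite (Primrec.eq.comp Primrec.snd (Primrec.succ.comp hn))
        (hs (.const a)) (.const (encode (∅ : Finset (ℕ × Fin 3)))))
    refine this.of_eq fun p => ?_
    simp only [clockMoves, apply_ite encode, Bool.false_eq_true, if_false]
  have ht : Primrec fun p : ℕ × ℕ => encode (clockMoves k a p.1 p.2 true) := by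
    have := Primrec.ite (Primrec.eq.comp (Primrec.nat_mod.comp Primrec.snd (.const 2)) (.const 0))
      (hs (.const a)) (.const (encode (∅ : Finset (ℕ × Fin 3))))
    refine this.of_eq fun p => ?_
    simp only [clockMoves, apply_ite encode, if_true]
  exact primrec_boolFunctionCode.comp (primrec_boolFunctionCode.comp hf hf)
    (primrec_boolFunctionCode.comp ht ht)

/-- The successors of a state, as pairs of the number of a state and a change of the counter. -/
noncomputable def numberedMoves (δ : Bool → Q → Q → Q → Q) (seed blank : Q) (H : Q → Prop) (n : ℕ)
    (i : Fin (historyAutomaton δ seed blank H n).k) (σ z : Bool) : Finset (ℕ × Fin 3) :=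
  ((historyAutomaton δ seed blank H n).trans i σ z).map
    (Fin.valEmbedding.prodMap (.refl (Fin 3)))

theorem mem_numberedMoves {i : Fin (historyAutomaton δ seed blank H n).k} {σ z : Bool}
    {p : ℕ × Fin 3} : p ∈ numberedMoves δ seed blank H n i σ z ↔
      Guess δ seed blank H n ((stateNumber Q).symm i) σ z ((stateNumber Q).symm p.1) p.2 := by
  simp only [numberedMoves, Finset.mem_map, mem_historyAutomaton_trans]
  constructor
  · rintro ⟨p, h, rfl⟩
    exact h
  · intro h
    refine ⟨(⟨p.1, ?_⟩, p.2), h, rfl⟩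
    simpa only [Equiv.apply_symm_apply] using h.stateNumber_lt

theorem encode_numberedMoves (i : Fin (historyAutomaton δ seed blank H n).k) (σ z : Bool) :
    encode (numberedMoves δ seed blank H n i σ z) =
      encode ((historyAutomaton δ seed blank H n).trans i σ z) :=
  encode_finset_map _ (fun _ => rfl) _

theorem encode_trans_of_lt (i : ℕ) (hi : i < Nat.card (Control Q))
    (h : i < (historyAutomaton δ seed blank H n).k)
    (h' : i < (historyAutomaton δ seed blank H 0).k) :
    encode ((historyAutomaton δ seed blank H n).trans ⟨i, h⟩) =
      encode ((historyAutomaton δ seed blank H 0).trans ⟨i, h'⟩) := by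
  obtain ⟨s, hs⟩ := exists_stateNumber_symm_of_lt hi
  have e : ∀ σ z, numberedMoves δ seed blank H n ⟨i, h⟩ σ z =
      numberedMoves δ seed blank H 0 ⟨i, h'⟩ σ z := by
    intro σ z
    ext p
    rw [mem_numberedMoves, mem_numberedMoves]
    dsimp only
    rw [hs]
    generalize (stateNumber Q).symm p.1 = s', p.2 = d
    constructor <;> intro h <;> cases h <;> constructor <;> assumption
  simp only [encode_bool_function, ← encode_numberedMoves, e]

theorem encode_trans_of_le (i : Fin (historyAutomaton δ seed blank H n).k)
    (hi : Nat.card (Control Q) ≤ i) :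
    encode ((historyAutomaton δ seed blank H n).trans i) =
      clockCode (Nat.card (Control Q)) (stateNumber Q (.inl .accept)) n
        (i - Nat.card (Control Q)) := by
  have e : ∀ σ z, numberedMoves δ seed blank H n i σ z =
      clockMoves (Nat.card (Control Q)) (stateNumber Q (.inl .accept)) n
        (i - Nat.card (Control Q)) σ := by
    intro σ z
    ext ⟨v, d⟩
    rw [mem_numberedMoves, stateNumber_symm_of_le hi]
    dsimp only
    obtain ⟨s, rfl⟩ := (stateNumber Q).surjective v
    rw [Equiv.symm_apply_apply]
    generalize (i : ℕ) - Nat.card (Control Q) = j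
    constructor
    · intro h
      cases h with
      | tick _ h => simp [clockMoves, h, stateNumber_inr, add_assoc]
      | early _ h => simp [clockMoves, h]
      | late _ h => simp [clockMoves, h]
    · intro h
      cases σ
      · simp only [clockMoves, Bool.false_eq_true, if_false] at h
        split_ifs at h with h1 h2
        · rw [Finset.mem_singleton, Prod.mk.injEq, add_assoc, ← stateNumber_inr,
            (stateNumber Q).apply_eq_iff_eq] at h
          obtain ⟨rfl, rfl⟩ := h
          exact .tick _ h1 _
        · rw [Finset.mem_singleton, Prod.mk.injEq, (stateNumber Q).apply_eq_iff_eq] at h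
          obtain ⟨rfl, rfl⟩ := h
          exact .late _ h2 _
        · simp at h
      · simp only [clockMoves, if_true] at h
        split_ifs at h with h1
        · rw [Finset.mem_singleton, Prod.mk.injEq, (stateNumber Q).apply_eq_iff_eq] at h
          obtain ⟨rfl, rfl⟩ := h
          exact .early _ h1 _
        · simp at h
  simp only [encode_bool_function, ← encode_numberedMoves, e, clockCode]

theorem primrec_encode_range_map {g : ℕ → ℕ → ℕ} (hg : Primrec₂ g) {k : ℕ → ℕ} (hk : Primrec k) :
    Primrec fun n => encode ((List.range (k n)).map fun i => Nat.pair i (g n i)) :=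
  Primrec.encode.comp (Primrec.list_map (Primrec.list_range.comp hk)
    (Primrec₂.natPair.comp Primrec.snd hg))

variable (δ seed blank H) in
theorem primrec_encode_historyAutomaton :
    Primrec fun n => (historyAutomaton δ seed blank H n).encode := by
  classical
  have hk : Primrec fun n => Nat.card (Control Q) + (4 * n + 2) :=
    Primrec.nat_add.comp (.const _)
      (Primrec.nat_add.comp (Primrec.nat_mul.comp (.const 4) .id) (.const 2))
  have hU : Primrec fun n => encode (historyAutomaton δ seed blank H n).isUniversal := by
    have hg : Primrec₂ fun _ i : ℕ =>
        if i < Nat.card (Control Q) then encode (decide (Branching ((stateNumber Q).symm i)))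
        else encode false := primrec_ite_lt (.const _)
          (fun i => encode (decide (Branching ((stateNumber Q).symm i)))) _
    refine (primrec_encode_range_map hg hk).of_eq fun n => ?_
    refine (encode_fin_function_eq_range _ _ fun i => ?_).symm
    split_ifs with hi
    · rfl
    · simp [historyAutomaton, stateNumber_symm_of_le (not_lt.1 hi), Branching.not_clock]
  have hT : Primrec fun n => encode (historyAutomaton δ seed blank H n).trans := by
    have hc : Primrec₂ fun n i => clockCode (Nat.card (Control Q))
        (stateNumber Q (.inl .accept)) n (i - Nat.card (Control Q)) :=
      (primrec_clockCode _ _).comp Primrec.fst (Primrec.nat_sub.comp .snd (.const _))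
    let f : ℕ → ℕ := fun i => if h : i < (historyAutomaton δ seed blank H 0).k then
      encode ((historyAutomaton δ seed blank H 0).trans ⟨i, h⟩) else 0
    refine (primrec_encode_range_map (primrec_ite_lt hc f (Nat.card (Control Q))) hk).of_eq
      fun n => ?_
    refine (encode_fin_function_eq_range _ _ fun i => ?_).symm
    split_ifs with hi
    · have h' : (i : ℕ) < (historyAutomaton δ seed blank H 0).k :=
        hi.trans_le (Nat.le_add_right _ _)
      simp only [f, dif_pos h']
      exact encode_trans_of_lt _ hi _ _
    · exact encode_trans_of_le _ (not_lt.1 hi)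
  exact Primrec₂.natPair.comp hk (Primrec₂.natPair.comp hU (Primrec₂.natPair.comp (.const _)
    (Primrec₂.natPair.comp (.const _) hT)))

end HistoryAutomaton

/-- The emptiness problem for unary A1CAs is undecidable: there is no total
computable function that, given (the natural effective encoding of) a unary A1CA `A`,
decides whether the language of `A` is empty. -/
theorem emptiness_unaryA1CA_undecidable :
    ¬ ∃ f : ℕ → Bool, Computable f ∧
        ∀ A : UnaryA1CA, (f A.encode = true ↔ A.lang = ∅) := by
  rintro ⟨f, hf, h⟩
  obtain ⟨Γ, Λ, _, _, _, _, M, x, y, z, hM⟩ := exists_undecidable_tm0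
  let A := historyAutomaton (machineRule M x y) (z, some default) (default, none) (IsHalted M)
  have hA : Primrec fun n => (A n).encode := primrec_encode_historyAutomaton _ _ _ _
  refine hM (ComputablePred.computable_iff.2 ⟨fun n => !f (A n).encode, ?_, ?_⟩)
  · exact Primrec.not.to_comp.comp (hf.comp hA.to_comp)
  · funext n
    rw [← exists_isHalted_iff (M := M) (y := y), ← historyAutomaton_lang_ne_empty_iff, Ne, ← h]
    simp [A]
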